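/- Let g1 and g2 be finite-dimensional real Lie algebras of dimensions 2n+1 and 2m+1 respectively. Suppose there are linear functionals ω1 on g1 and ω1' on g2 vanishing on the derived subalgebras [g1,g1] and [g2,g2] respectively, elements X1 ∈ g1 and X1' ∈ g2 with ω1(X1) = 1 and ω1'(X1') = 1, and alternating bilinear forms θ on g1 and θ' on g2, each satisfying the closedness (2-cocycle) condition, such that θ(X1, ·) = 0, θ'(X1', ·) = 0, the restriction of θ to ker ω1 is nondegenerate, and the restriction of θ' to ker ω1' is nondegenerate. Then the alternating bilinear form η on g1 ⊕ g2 defined by η((x,x'),(y,y')) = θ(x,y) + θ'(x',y') + ω1(x)ω1'(y') − ω1(y)ω1'(x') is a symplectic form on the direct sum Lie algebra g1 ⊕ g2. -/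

import Mathlib

/-- If an alternating bilinear form vanishes with `a` in its first argument, it also vanishes
with `a` in its second argument. -/
theorem LinearMap.apply_right_eq_zero_of_alt {V : Type*} [AddCommGroup V] [Module ℝ V]
    (θ : V →ₗ[ℝ] V →ₗ[ℝ] ℝ) (halt : ∀ x, θ x x = 0) {a : V} (ha : ∀ y, θ a y = 0) (x : V) :
    θ x a = 0 :=
  (show θ.IsAlt from halt).isRefl a x (ha x)

/-- If two odd-dimensional real Lie algebras carry closed alternating bilinear forms
annihilating a chosen element `X1` (resp. `X1'`) with `ω1 X1 = 1` (`ω1` vanishing on the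
derived subalgebra) and nondegenerate on `ker ω1`, then the form
`η((x,x'),(y,y')) = θ x y + θ' x' y' + ω1 x * ω1' y' − ω1 y * ω1' x'`
is a symplectic form on the direct sum Lie algebra `g1 ⊕ g2` (componentwise bracket). -/
theorem symplectic_of_direct_sum
    (g1 g2 : Type*) [LieRing g1] [LieAlgebra ℝ g1] [LieRing g2] [LieAlgebra ℝ g2]
    [Module.Finite ℝ g1] [Module.Finite ℝ g2] (n m : ℕ)
    (hdim1 : Module.finrank ℝ g1 = 2 * n + 1)
    (hdim2 : Module.finrank ℝ g2 = 2 * m + 1)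
    (ω1 : g1 →ₗ[ℝ] ℝ) (ω1' : g2 →ₗ[ℝ] ℝ)
    (hω1der : ∀ x y : g1, ω1 ⁅x, y⁆ = 0)
    (hω1'der : ∀ x y : g2, ω1' ⁅x, y⁆ = 0)
    (X1 : g1) (X1' : g2) (hX1 : ω1 X1 = 1) (hX1' : ω1' X1' = 1)
    (θ : g1 →ₗ[ℝ] g1 →ₗ[ℝ] ℝ) (θ' : g2 →ₗ[ℝ] g2 →ₗ[ℝ] ℝ)
    (hθalt : ∀ x, θ x x = 0) (hθ'alt : ∀ x, θ' x x = 0)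
    (hθclosed : ∀ x y z : g1, θ ⁅x, y⁆ z + θ ⁅y, z⁆ x + θ ⁅z, x⁆ y = 0)
    (hθ'closed : ∀ x y z : g2, θ' ⁅x, y⁆ z + θ' ⁅y, z⁆ x + θ' ⁅z, x⁆ y = 0)
    (hθX1 : ∀ y, θ X1 y = 0) (hθ'X1' : ∀ y, θ' X1' y = 0)
    (hθnd : ∀ x, ω1 x = 0 → (∀ y, ω1 y = 0 → θ x y = 0) → x = 0)
    (hθ'nd : ∀ x, ω1' x = 0 → (∀ y, ω1' y = 0 → θ' x y = 0) → x = 0) :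
    -- `η` is a symplectic form on the direct sum Lie algebra `g1 ⊕ g2`:
    (∀ p : g1 × g2,
      (θ p.1 p.1 + θ' p.2 p.2 + ω1 p.1 * ω1' p.2 - ω1 p.1 * ω1' p.2) = 0) ∧
    (∀ p : g1 × g2,
      (∀ q : g1 × g2,
        θ p.1 q.1 + θ' p.2 q.2 + ω1 p.1 * ω1' q.2 - ω1 q.1 * ω1' p.2 = 0) → p = 0) ∧
    (∀ p q r : g1 × g2,
      (θ ⁅p.1, q.1⁆ r.1 + θ' ⁅p.2, q.2⁆ r.2
        + ω1 ⁅p.1, q.1⁆ * ω1' r.2 - ω1 r.1 * ω1' ⁅p.2, q.2⁆)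
      + (θ ⁅q.1, r.1⁆ p.1 + θ' ⁅q.2, r.2⁆ p.2
        + ω1 ⁅q.1, r.1⁆ * ω1' p.2 - ω1 p.1 * ω1' ⁅q.2, r.2⁆)
      + (θ ⁅r.1, p.1⁆ q.1 + θ' ⁅r.2, p.2⁆ q.2
        + ω1 ⁅r.1, p.1⁆ * ω1' q.2 - ω1 q.1 * ω1' ⁅r.2, p.2⁆) = 0) := by
  refine ⟨fun p => by rw [hθalt, hθ'alt]; ring, ?_, ?_⟩
  · rintro ⟨x, x'⟩ h
    have hx' : ω1' x' = 0 := by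
      simpa [hX1, θ.apply_right_eq_zero_of_alt hθalt hθX1] using h (X1, 0)
    have hx : ω1 x = 0 := by
      simpa [hX1', θ'.apply_right_eq_zero_of_alt hθ'alt hθ'X1'] using h (0, X1')
    refine Prod.ext (hθnd x hx fun y _ => ?_) (hθ'nd x' hx' fun y _ => ?_)
    · simpa [hx'] using h (y, 0)
    · simpa [hx] using h (0, y)
  · intro p q r
    simp only [hω1der, hω1'der]
    linear_combination hθclosed p.1 q.1 r.1 + hθ'closed p.2 q.2 r.2
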